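/- arXiv:1309.1035 — 9 statements merged into one kernel-verified Lean document; each statement's English description precedes it below -/
import Mathlib

section
/- Let R be a Noetherian commutative ring of characteristic p such that the Frobenius of R is finite, i.e., the ring homomorphism R → R, r ↦ r^q, makes R into a finitely generated module over itself. Let 0 → M' → M → M'' → 0 be a short exact sequence of Cartier modules over R (the maps being R-linear, commuting with the respective κ's, with the first map injective, the second surjective, and the image of the first equal to the kernel of the second). If M' and M'' are ind-coherent, then M is ind-coherent. -/
/-- A finite ring homomorphism `φ : A →+* B` has a finite set of module generators, stated as an
induction principle for additive subgroups of `B` stable under multiplication by `φ`. -/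
theorem RingHom.Finite.exists_finite_generators {A B : Type*} [CommRing A] [CommRing B]
    {φ : A →+* B} (hφ : φ.Finite) :
    ∃ T : Set B, T.Finite ∧ ∀ G : AddSubgroup B, T ⊆ G →
      (∀ a : A, ∀ b ∈ G, φ a * b ∈ G) → ∀ b, b ∈ G := by
  letI := φ.toAlgebra
  obtain ⟨T, hT⟩ := (show Module.Finite A B from hφ).fg_top
  refine ⟨T, T.finite_toSet, fun G hTG hG b => ?_⟩
  have hb : b ∈ Submodule.span A (T : Set B) := hT ▸ Submodule.mem_top
  induction hb using Submodule.span_induction with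
  | mem x hx => exact hTG hx
  | zero => exact G.zero_mem
  | add x y _ _ hx hy => exact G.add_mem hx hy
  | smul a x _ hx => exact Algebra.smul_def a x ▸ hG a x hx

/-- If `φ` is finite and `κ (φ r • m) = r • κ m`, then the image under `κ` of a finitely generated
submodule is spanned by the image of a finite subset. -/
theorem Submodule.FG.exists_finite_map_mem_span {R M : Type*} [CommRing R] [AddCommGroup M]
    [Module R M] {φ : R →+* R} (hφ : φ.Finite) (κ : M →+ M)
    (hκ : ∀ (r : R) (m : M), κ (φ r • m) = r • κ m) {P : Submodule R M} (hP : P.FG) :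
    ∃ V : Set M, V.Finite ∧ V ⊆ P ∧ ∀ x ∈ P, κ x ∈ Submodule.span R (κ '' V) := by
  obtain ⟨S, rfl⟩ := hP
  obtain ⟨T, hT, hgen⟩ := hφ.exists_finite_generators
  refine ⟨Set.image2 (· • ·) T (S : Set M), hT.image2 _ S.finite_toSet, ?_, fun x hx => ?_⟩
  · rintro _ ⟨t, -, x, hx, rfl⟩
    exact Submodule.smul_mem _ t (Submodule.subset_span hx)
  · set Q := Submodule.span R (κ '' Set.image2 (· • ·) T (S : Set M)) with hQ
    suffices h : ∀ r : R, κ (r • x) ∈ Q by simpa using h 1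
    induction hx using Submodule.span_induction with
    | mem x hx =>
      refine hgen (Q.toAddSubgroup.comap (κ.comp (AddMonoidHom.flip (smulAddHom R M) x)))
        (fun t ht => ?_) (fun a b hb => ?_)
      · exact Submodule.subset_span ⟨t • x, ⟨t, ht, x, hx, rfl⟩, rfl⟩
      · change κ ((φ a * b) • x) ∈ Q
        rw [mul_smul, hκ]
        exact Q.smul_mem a hb
    | zero => simp
    | add x y _ _ hx hy =>
      intro r
      rw [smul_add, map_add]
      exact Q.add_mem (hx r) (hy r)
    | smul a x _ hx =>
      intro r
      rw [smul_smul]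
      exact hx _

/-- In an ind-coherent Cartier module, each finite subset lies in a finitely generated stable
submodule. -/
theorem Set.Finite.exists_fg_stable_submodule {R M : Type*} [CommRing R] [AddCommGroup M]
    [Module R M] (κ : M →+ M)
    (h : ∀ m : M, ∃ N : Submodule R M, N.FG ∧ (∀ x ∈ N, κ x ∈ N) ∧ m ∈ N)
    {Z : Set M} (hZ : Z.Finite) :
    ∃ N : Submodule R M, N.FG ∧ (∀ x ∈ N, κ x ∈ N) ∧ Z ⊆ N := by
  induction Z, hZ using Set.Finite.induction_on with
  | empty => exact ⟨⊥, Submodule.fg_bot, by simp, Set.empty_subset _⟩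
  | @insert a Z _ _ ih =>
    obtain ⟨N, hN, hκN, hZN⟩ := ih
    obtain ⟨L, hL, hκL, haL⟩ := h a
    refine ⟨L ⊔ N, hL.sup hN, fun x hx => ?_, Set.insert_subset
      (Submodule.mem_sup_left haL) (hZN.trans (SetLike.coe_subset_coe.2 le_sup_right))⟩
    obtain ⟨y, hy, z, hz, rfl⟩ := Submodule.mem_sup.1 hx
    rw [map_add]
    exact Submodule.add_mem_sup (hκL y hy) (hκN z hz)

/-- A finitely generated submodule of the target of a surjection, together with a preimage of one
of its elements, lifts to a finitely generated submodule. -/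
theorem Submodule.FG.exists_fg_map_eq {R M N : Type*} [CommRing R] [AddCommGroup M] [Module R M]
    [AddCommGroup N] [Module R N] {g : M →ₗ[R] N} (hg : Function.Surjective g)
    {Q : Submodule R N} (hQ : Q.FG) {m : M} (hm : g m ∈ Q) :
    ∃ P : Submodule R M, P.FG ∧ P.map g = Q ∧ m ∈ P := by
  classical
  obtain ⟨S, rfl⟩ := hQ
  refine ⟨Submodule.span R (insert m (S.image (Function.surjInv hg)) : Finset M), ⟨_, rfl⟩, ?_,
    Submodule.subset_span (by simp)⟩
  have hS : g '' (Function.surjInv hg '' (S : Set N)) = S := by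
    simp [Set.image_image, Function.surjInv_eq]
  rw [Submodule.map_span, Finset.coe_insert, Finset.coe_image, Set.image_insert_eq, hS,
    Submodule.span_insert_eq_span hm]

/-- Proposition 2.0.8 (affine form): over a Noetherian ring `R` of characteristic `p` with
finite Frobenius, an extension of ind-coherent Cartier modules is ind-coherent. -/
theorem stmt_3 {R : Type*} [CommRing R] [IsNoetherianRing R]
    (p : ℕ) (hp : p.Prime) [CharP R p] (s : ℕ) (hs : 1 ≤ s) (q : ℕ) (hq : q = p ^ s)
    (φ : R →+* R) (hφ : ∀ r : R, φ r = r ^ q) (hfin : φ.Finite)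
    {M' M M'' : Type*} [AddCommGroup M'] [Module R M'] [AddCommGroup M] [Module R M]
    [AddCommGroup M''] [Module R M'']
    (κ' : M' → M') (κ : M → M) (κ'' : M'' → M'')
    (hadd' : ∀ x y : M', κ' (x + y) = κ' x + κ' y)
    (hκ' : ∀ (r : R) (m : M'), κ' (r ^ q • m) = r • κ' m)
    (hadd : ∀ x y : M, κ (x + y) = κ x + κ y)
    (hκ : ∀ (r : R) (m : M), κ (r ^ q • m) = r • κ m)
    (hadd'' : ∀ x y : M'', κ'' (x + y) = κ'' x + κ'' y)
    (hκ'' : ∀ (r : R) (m : M''), κ'' (r ^ q • m) = r • κ'' m)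
    (f : M' →ₗ[R] M) (g : M →ₗ[R] M'')
    (hfinj : Function.Injective f) (hgsurj : Function.Surjective g)
    (hexact : LinearMap.range f = LinearMap.ker g)
    (hfκ : ∀ x : M', f (κ' x) = κ (f x))
    (hgκ : ∀ x : M, g (κ x) = κ'' (g x))
    (hM' : ∀ m : M', ∃ N : Submodule R M', N.FG ∧ (∀ x ∈ N, κ' x ∈ N) ∧ m ∈ N)
    (hM'' : ∀ m : M'', ∃ N : Submodule R M'', N.FG ∧ (∀ x ∈ N, κ'' x ∈ N) ∧ m ∈ N) :
    ∀ m : M, ∃ N : Submodule R M, N.FG ∧ (∀ x ∈ N, κ x ∈ N) ∧ m ∈ N := by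
  subst hq
  intro m
  let k' : M' →+ M' := AddMonoidHom.mk' κ' hadd'
  let k : M →+ M := AddMonoidHom.mk' κ hadd
  obtain ⟨Q, hQ, hκQ, hmQ⟩ := hM'' (g m)
  obtain ⟨P, hP, rfl, hmP⟩ := hQ.exists_fg_map_eq hgsurj hmQ
  obtain ⟨V, hV, hVP, hspan⟩ := hP.exists_finite_map_mem_span hfin k
    (fun r x => by rw [hφ]; exact hκ r x)
  have hlift : ∀ v ∈ V, ∃ z : M', κ v - f z ∈ P := fun v hv => by
    obtain ⟨y, hy, hyv⟩ := hκQ (g v) (Submodule.mem_map_of_mem (hVP hv))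
    have hker : κ v - y ∈ LinearMap.range f := by
      rw [hexact, LinearMap.mem_ker, map_sub, hgκ, hyv, sub_self]
    obtain ⟨z, hz⟩ := hker
    exact ⟨z, by rwa [hz, sub_sub_cancel]⟩
  choose! z hz using hlift
  obtain ⟨N, hN, hκN, hzN⟩ := (hV.image z).exists_fg_stable_submodule k' hM'
  have hκP : ∀ x ∈ P, κ x ∈ P ⊔ N.map f := fun x hx => by
    refine Submodule.span_le.2 ?_ (hspan x hx)
    rintro _ ⟨v, hv, rfl⟩
    have := Submodule.add_mem_sup (hz v hv)
      (Submodule.mem_map_of_mem (f := f) (hzN (Set.mem_image_of_mem z hv)))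
    rwa [sub_add_cancel] at this
  refine ⟨P ⊔ N.map f, hP.sup (hN.map f), fun x hx => ?_, Submodule.mem_sup_left hmP⟩
  obtain ⟨y, hy, _, ⟨w, hw, rfl⟩, rfl⟩ := Submodule.mem_sup.1 hx
  rw [hadd, ← hfκ]
  exact add_mem (hκP y hy) (Submodule.mem_sup_right (Submodule.mem_map_of_mem (hκN w hw)))
end

section
/- Let R be a Noetherian commutative ring of characteristic p and let 0 → M' → M → M'' → 0 be a short exact sequence of Cartier modules over R. If M' and M'' are locally nilpotent and M is ind-coherent, then M is locally nilpotent. -/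
/-- A finitely generated submodule of a locally nilpotent module with an additive
endomorphism is killed by a power of the endomorphism. -/
theorem Submodule.FG.exists_iterate_eq_zero {R M : Type*} [Semiring R] [AddCommMonoid M]
    [Module R M] {κ : M → M} (hadd : ∀ x y, κ (x + y) = κ x + κ y) (hzero : κ 0 = 0)
    (hM : ∀ m : M, ∃ N : Submodule R M, m ∈ N ∧ (∀ x ∈ N, κ x ∈ N) ∧
      ∃ e : ℕ, ∀ x ∈ N, κ^[e] x = 0)
    {P : Submodule R M} (hP : P.FG) : ∃ e : ℕ, ∀ x ∈ P, κ^[e] x = 0 := by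
  induction P, hP using Submodule.fg_induction with
  | singleton m =>
    obtain ⟨N, hmN, -, e, he⟩ := hM m
    exact ⟨e, fun x hx => he x ((Submodule.span_singleton_le_iff_mem m N).2 hmN hx)⟩
  | sup P Q _ _ hP hQ =>
    obtain ⟨a, ha⟩ := hP
    obtain ⟨b, hb⟩ := hQ
    refine ⟨a + b, fun x hx => ?_⟩
    obtain ⟨y, hy, z, hz, rfl⟩ := Submodule.mem_sup.1 hx
    let φ : M →+ M := ⟨⟨κ, hzero⟩, hadd⟩
    have h_add : κ^[a + b] (y + z) = κ^[a + b] y + κ^[a + b] z := iterate_map_add φ _ _ _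
    rw [h_add, Function.iterate_add_apply κ a b z, hb z hz, add_comm a b,
      Function.iterate_add_apply κ b a y, ha y hy, Function.iterate_fixed hzero,
      Function.iterate_fixed hzero, add_zero]

/-- Part of Proposition 2.1.5 (affine form): over a Noetherian ring `R` of characteristic
`p`, an extension of locally nilpotent Cartier modules which is ind-coherent is itself
locally nilpotent. -/
theorem stmt_4 {R : Type*} [CommRing R] [IsNoetherianRing R]
    (p : ℕ) (hp : p.Prime) [CharP R p] (s : ℕ) (hs : 1 ≤ s) (q : ℕ) (hq : q = p ^ s)
    {M' M M'' : Type*} [AddCommGroup M'] [Module R M'] [AddCommGroup M] [Module R M]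
    [AddCommGroup M''] [Module R M'']
    (κ' : M' → M') (κ : M → M) (κ'' : M'' → M'')
    (hadd' : ∀ x y : M', κ' (x + y) = κ' x + κ' y)
    (hκ' : ∀ (r : R) (m : M'), κ' (r ^ q • m) = r • κ' m)
    (hadd : ∀ x y : M, κ (x + y) = κ x + κ y)
    (hκ : ∀ (r : R) (m : M), κ (r ^ q • m) = r • κ m)
    (hadd'' : ∀ x y : M'', κ'' (x + y) = κ'' x + κ'' y)
    (hκ'' : ∀ (r : R) (m : M''), κ'' (r ^ q • m) = r • κ'' m)
    (f : M' →ₗ[R] M) (g : M →ₗ[R] M'')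
    (hfinj : Function.Injective f) (hgsurj : Function.Surjective g)
    (hexact : LinearMap.range f = LinearMap.ker g)
    (hfκ : ∀ x : M', f (κ' x) = κ (f x))
    (hgκ : ∀ x : M, g (κ x) = κ'' (g x))
    -- `M'` is locally nilpotent
    (hM' : ∀ m : M', ∃ N : Submodule R M', m ∈ N ∧ (∀ x ∈ N, κ' x ∈ N) ∧
      ∃ e : ℕ, ∀ x ∈ N, κ'^[e] x = 0)
    -- `M''` is locally nilpotent
    (hM'' : ∀ m : M'', ∃ N : Submodule R M'', m ∈ N ∧ (∀ x ∈ N, κ'' x ∈ N) ∧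
      ∃ e : ℕ, ∀ x ∈ N, κ''^[e] x = 0)
    -- `M` is ind-coherent
    (hMind : ∀ m : M, ∃ N : Submodule R M, N.FG ∧ (∀ x ∈ N, κ x ∈ N) ∧ m ∈ N) :
    -- `M` is locally nilpotent
    ∀ m : M, ∃ N : Submodule R M, m ∈ N ∧ (∀ x ∈ N, κ x ∈ N) ∧
      ∃ e : ℕ, ∀ x ∈ N, κ^[e] x = 0 := by
  intro m
  obtain ⟨N, hN, hNκ, hmN⟩ := hMind m
  refine ⟨N, hmN, hNκ, ?_⟩
  have hzero' : κ' 0 = 0 := by simpa using hadd' 0 0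
  have hzero'' : κ'' 0 = 0 := by simpa using hadd'' 0 0
  have hcomap : (N.comap f).FG :=
    Submodule.fg_of_fg_map_injective f hfinj (hN.of_le (Submodule.map_comap_le f N))
  obtain ⟨a, ha⟩ := hcomap.exists_iterate_eq_zero hadd' hzero' hM'
  obtain ⟨b, hb⟩ := (hN.map g).exists_iterate_eq_zero hadd'' hzero'' hM''
  refine ⟨a + b, fun x hx => ?_⟩
  have hker : κ^[b] x ∈ LinearMap.range f := by
    rw [hexact, LinearMap.mem_ker, Function.Semiconj.iterate_right hgκ b x]
    exact hb _ (Submodule.mem_map_of_mem hx)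
  obtain ⟨y, hy⟩ := hker
  have hyN : y ∈ N.comap f := by
    rw [Submodule.mem_comap, hy]
    exact Set.MapsTo.iterate (s := (N : Set M)) hNκ b hx
  rw [Function.iterate_add_apply, ← hy, ← Function.Semiconj.iterate_right hfκ a y, ha y hyN,
    map_zero]
end

section
/- Let R be a commutative ring of characteristic p and φ : M → N a morphism of Cartier modules over R (R-linear with φ ∘ κ_M = κ_N ∘ φ). (i) Suppose there exist n ≥ 0 and an additive map α : N → M satisfying α(r^{q^n} • x) = r • α(x) for all r ∈ R and x ∈ N, κ_M ∘ α = α ∘ κ_N, α ∘ φ = κ_M^n, and φ ∘ α = κ_N^n. Then κ_M^n vanishes on ker φ and κ_N^n(N) ⊆ im φ; in particular kernel and cokernel of φ are nilpotent. (ii) Conversely, if R is Noetherian, M and N are finitely generated R-modules, and there exist e, e' ≥ 0 with κ_M^e(ker φ) = 0 and κ_N^{e'}(N) ⊆ im φ, then there exist such n and α. -/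
theorem Function.iterate_map_add_of_additive {A : Type*} [Add A] {κ : A → A}
    (hadd : ∀ x y, κ (x + y) = κ x + κ y) (k : ℕ) (x y : A) :
    κ^[k] (x + y) = κ^[k] x + κ^[k] y := by
  induction k generalizing x y with
  | zero => rfl
  | succ k ih => rw [Function.iterate_succ_apply, hadd, ih]; rfl

theorem Function.iterate_pow_smul {R A : Type*} [Monoid R] [SMul R A] {κ : A → A} {q : ℕ}
    (hκ : ∀ (r : R) (m : A), κ (r ^ q • m) = r • κ m) (k : ℕ) (r : R) (m : A) :
    κ^[k] (r ^ q ^ k • m) = r • κ^[k] m := by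
  induction k generalizing m with
  | zero => simp
  | succ k ih => rw [Function.iterate_succ_apply, pow_succ, pow_mul, hκ, ih]; rfl

/-- Proposition 2.3.2 (affine form): a morphism `φ` of Cartier modules has nilpotent kernel
and cokernel if and only if (for finitely generated modules over a Noetherian ring) there is
`n` and a Frobenius-`q^n`-semilinear map `α` with `α ∘ φ = κ_M^n` and `φ ∘ α = κ_N^n`. -/
theorem stmt_6 {R : Type*} [CommRing R]
    (p : ℕ) (hp : p.Prime) [CharP R p] (s : ℕ) (hs : 1 ≤ s) (q : ℕ) (hq : q = p ^ s)
    {M N : Type*} [AddCommGroup M] [Module R M] [AddCommGroup N] [Module R N]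
    (κM : M → M) (κN : N → N)
    (haddM : ∀ x y : M, κM (x + y) = κM x + κM y)
    (hκM : ∀ (r : R) (m : M), κM (r ^ q • m) = r • κM m)
    (haddN : ∀ x y : N, κN (x + y) = κN x + κN y)
    (hκN : ∀ (r : R) (m : N), κN (r ^ q • m) = r • κN m)
    (φ : M →ₗ[R] N) (hφκ : ∀ x : M, φ (κM x) = κN (φ x)) :
    -- (i): existence of such an `α` forces nilpotent kernel and cokernel
    (∀ (n : ℕ) (α : N → M),
      (∀ x y : N, α (x + y) = α x + α y) →
      (∀ (r : R) (x : N), α (r ^ q ^ n • x) = r • α x) →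
      (∀ x : N, κM (α x) = α (κN x)) →
      (∀ x : M, α (φ x) = κM^[n] x) →
      (∀ x : N, φ (α x) = κN^[n] x) →
      (∀ x : M, φ x = 0 → κM^[n] x = 0) ∧ (∀ y : N, κN^[n] y ∈ LinearMap.range φ)) ∧
    -- (ii): converse for finitely generated modules over a Noetherian ring
    (IsNoetherianRing R → Module.Finite R M → Module.Finite R N →
      (∃ e : ℕ, ∀ x : M, φ x = 0 → κM^[e] x = 0) →
      (∃ e' : ℕ, ∀ y : N, κN^[e'] y ∈ LinearMap.range φ) →
      ∃ (n : ℕ) (α : N → M),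
        (∀ x y : N, α (x + y) = α x + α y) ∧
        (∀ (r : R) (x : N), α (r ^ q ^ n • x) = r • α x) ∧
        (∀ x : N, κM (α x) = α (κN x)) ∧
        (∀ x : M, α (φ x) = κM^[n] x) ∧
        (∀ x : N, φ (α x) = κN^[n] x)) := by
  refine ⟨fun n α hadd _ _ hαφ hφα => ⟨fun x hx => ?_, fun y => ⟨α y, hφα y⟩⟩, ?_⟩
  · rw [← hαφ, hx]
    exact (AddMonoidHom.mk' α hadd).map_zero
  rintro - - - ⟨e, he⟩ ⟨e', he'⟩
  have hφ (k : ℕ) (x : M) : φ (κM^[k] x) = κN^[k] (φ x) :=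
    (show Function.Semiconj φ κM κN from hφκ).iterate_right k x
  have key {a b : M} (h : φ a = φ b) : κM^[e] a = κM^[e] b := by
    have h_sum := Function.iterate_map_add_of_additive haddM e (a - b) b
    rwa [sub_add_cancel, he (a - b) (by rw [map_sub, h, sub_self]), zero_add] at h_sum
  choose g hg using he'
  refine ⟨e + e', fun y => κM^[e] (g y), fun x y => ?_, fun r x => ?_, fun x => ?_,
    fun x => ?_, fun x => ?_⟩
  · rw [← Function.iterate_map_add_of_additive haddM]
    apply key
    rw [map_add, hg, hg, hg, Function.iterate_map_add_of_additive haddN]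
  · rw [← Function.iterate_pow_smul hκM]
    apply key
    rw [map_smul, hg, hg, pow_add, pow_mul, Function.iterate_pow_smul hκN]
  · rw [← Function.iterate_succ_apply' κM, Function.iterate_succ_apply]
    apply key
    rw [hφκ, hg, hg, ← Function.iterate_succ_apply' κN, Function.iterate_succ_apply]
  · rw [Function.iterate_add_apply]
    apply key
    rw [hg, hφ]
  · rw [hφ, hg, Function.iterate_add_apply]
end

section
/- Let R be a Noetherian commutative ring of characteristic p whose Frobenius r ↦ r^q is a finite ring map (R is a finitely generated module over itself via r ↦ r^q). Let M be a finitely generated module over the polynomial ring R[X] equipped with an additive map κ : M → M satisfying κ(f^q • m) = f • κ(m) for all f ∈ R[X] and m ∈ M. Then M contains a finitely generated R-submodule N with κ(N) ⊆ N such that M/N is locally nilpotent over R: for every finitely generated R-submodule U of M there exists e ≥ 0 with κ^e(U) ⊆ N. -/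
open Polynomial in
/-- The `R`-submodule of an `R[X]`-module spanned by the `X ^ j • g` with `j ≤ d` and `g ∈ G`. -/
def degreeSpan (R : Type*) {M : Type*} [CommRing R] [AddCommGroup M] [Module (Polynomial R) M]
    [Module R M] (G : Finset M) (d : ℕ) : Submodule R M :=
  Submodule.span R ((fun y : ℕ × M => (X : R[X]) ^ y.1 • y.2) '' (Finset.range (d + 1) ×ˢ G))

/-- A finite ring map makes its target additively generated by the multiples of a finite set. -/
theorem RingHom.Finite.exists_finset_closure {A B : Type*} [CommRing A] [CommRing B]
    {φ : A →+* B} (h : φ.Finite) :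
    ∃ S : Finset B, ∀ b, b ∈ AddSubmonoid.closure {z | ∃ a, ∃ t ∈ S, z = φ a * t} := by
  let := φ.toAlgebra
  obtain ⟨S, hS⟩ := Module.finite_def.mp (show Module.Finite A B from h)
  refine ⟨S, fun b => ?_⟩
  have hb : b ∈ Submodule.span A (S : Set B) := hS ▸ Submodule.mem_top
  induction hb using Submodule.closure_induction with
  | zero => exact zero_mem _
  | add x y _ _ hx hy => exact add_mem hx hy
  | smul_mem r x hx => exact AddSubmonoid.subset_closure ⟨r, x, hx, Algebra.smul_def r x⟩

section

open Polynomial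

variable {R M : Type*} [CommRing R] [AddCommGroup M] [Module R[X] M] [Module R M]

theorem degreeSpan_fg (G : Finset M) (d : ℕ) : (degreeSpan R G d).FG :=
  Submodule.fg_span (((Finset.range (d + 1) ×ˢ G).finite_toSet.subset (by simp)).image _)

theorem X_pow_smul_mem_degreeSpan {G : Finset M} {g : M} (hg : g ∈ G) {j d : ℕ} (h : j ≤ d) :
    (X : R[X]) ^ j • g ∈ degreeSpan R G d :=
  Submodule.subset_span ⟨(j, g), by simp [hg]; omega, rfl⟩

theorem degreeSpan_induction {G : Finset M} {d : ℕ} {P : M → Prop}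
    (mem : ∀ j ≤ d, ∀ g ∈ G, P ((X : R[X]) ^ j • g)) (zero : P 0)
    (add : ∀ x y, P x → P y → P (x + y)) (smul : ∀ (r : R) x, P x → P (r • x))
    {x : M} (hx : x ∈ degreeSpan R G d) : P x := by
  induction hx using Submodule.span_induction with
  | mem x h =>
    obtain ⟨⟨j, g⟩, h, rfl⟩ := h
    simp only [Set.mem_prod, Finset.mem_coe, Finset.mem_range] at h
    exact mem j (by omega) g h.2
  | zero => exact zero
  | add x y _ _ hx hy => exact add x y hx hy
  | smul r x _ hx => exact smul r x hx

theorem degreeSpan_mono (G : Finset M) : Monotone (degreeSpan R G) := fun _ _ hde _ hx =>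
  degreeSpan_induction (fun _ hj _ hg => X_pow_smul_mem_degreeSpan hg (hj.trans hde)) (zero_mem _)
    (fun _ _ => add_mem) (fun r _ => Submodule.smul_mem _ r) hx

variable [IsScalarTower R R[X] M]

theorem X_pow_smul_mem_degreeSpan_add {G : Finset M} {d : ℕ} (n : ℕ) {x : M}
    (hx : x ∈ degreeSpan R G d) : (X : R[X]) ^ n • x ∈ degreeSpan R G (n + d) := by
  refine degreeSpan_induction (P := fun x => (X : R[X]) ^ n • x ∈ degreeSpan R G (n + d))
    (fun j hj g hg => ?_) ?_ (fun x y hx hy => ?_) (fun r x hx => ?_) hx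
  · rw [smul_smul, ← pow_add]
    exact X_pow_smul_mem_degreeSpan hg (by omega)
  · simp
  · rw [smul_add]
    exact add_mem hx hy
  · have : (X : R[X]) ^ n • r • x = r • (X : R[X]) ^ n • x := by
      rw [← algebraMap_smul R[X] r x, ← algebraMap_smul R[X] r (_ • x), smul_smul, smul_smul,
        mul_comm]
    rw [this]
    exact Submodule.smul_mem _ r hx

theorem exists_mem_degreeSpan {G : Finset M} (hG : Submodule.span R[X] (G : Set M) = ⊤) (x : M) :
    ∃ d, x ∈ degreeSpan R G d := by
  have add {x y : M} (hx : ∃ d, x ∈ degreeSpan R G d) (hy : ∃ d, y ∈ degreeSpan R G d) :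
      ∃ d, x + y ∈ degreeSpan R G d := by
    obtain ⟨d, hd⟩ := hx
    obtain ⟨e, he⟩ := hy
    exact ⟨max d e, add_mem (degreeSpan_mono G (le_max_left d e) hd)
      (degreeSpan_mono G (le_max_right d e) he)⟩
  have hx : x ∈ Submodule.span R[X] (G : Set M) := hG ▸ Submodule.mem_top
  induction hx using Submodule.span_induction with
  | mem x h => exact ⟨0, by simpa using X_pow_smul_mem_degreeSpan (R := R) h (Nat.zero_le 0)⟩
  | zero => exact ⟨0, zero_mem _⟩
  | add x y _ _ hx hy => exact add hx hy
  | smul f x _ hx =>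
    induction f using Polynomial.induction_on' with
    | add f g hf hg =>
      rw [add_smul]
      exact add hf hg
    | monomial n r =>
      obtain ⟨d, hd⟩ := hx
      refine ⟨n + d, ?_⟩
      rw [← C_mul_X_pow_eq_monomial, mul_smul, ← algebraMap_eq, algebraMap_smul]
      exact Submodule.smul_mem _ r (X_pow_smul_mem_degreeSpan_add n hd)

/-- Finitely many elements lie in a common step of an exhaustive degree filtration. -/
theorem exists_forall_mem_degreeSpan {G : Finset M}
    (hG : Submodule.span R[X] (G : Set M) = ⊤) (T : Finset M) :
    ∃ d, ∀ x ∈ T, x ∈ degreeSpan R G d := by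
  choose d hd using exists_mem_degreeSpan (R := R) hG
  exact ⟨T.sup d, fun x hx => degreeSpan_mono G (Finset.le_sup hx) (hd x)⟩

/-- A Cartier operator contracts the degree filtration by the factor `q`, up to a constant. -/
theorem exists_map_degreeSpan_le {q : ℕ} (hq : 0 < q) {φ : R →+* R} (hφ : ∀ r, φ r = r ^ q)
    (hfin : φ.Finite) (κ : M →+ M) (hκ : ∀ (f : R[X]) (m : M), κ (f ^ q • m) = f • κ m)
    {G : Finset M} (hG : Submodule.span R[X] (G : Set M) = ⊤) :
    ∃ D, ∀ d, ∀ x ∈ degreeSpan R G d, κ x ∈ degreeSpan R G (d / q + D) := by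
  classical
  obtain ⟨S, hS⟩ := hfin.exists_finset_closure
  obtain ⟨D, hD⟩ := exists_forall_mem_degreeSpan hG
    ((S ×ˢ Finset.range q ×ˢ G).image fun y => κ (C y.1 • (X : R[X]) ^ y.2.1 • y.2.2))
  refine ⟨D, fun d x hx => ?_⟩
  suffices h : ∀ r : R, κ (r • x) ∈ degreeSpan R G (d / q + D) by simpa using h 1
  refine degreeSpan_induction (P := fun x => ∀ r : R, κ (r • x) ∈ degreeSpan R G (d / q + D))
    (fun j hj g hg r => ?_) (by simp) (fun x y hx hy r => ?_)
    (fun a x hx r => by rw [smul_smul]; exact hx _) hx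
  · induction hS r using AddSubmonoid.closure_induction with
    | zero => simp
    | add a b _ _ ha hb =>
      rw [add_smul, map_add]
      exact add_mem ha hb
    | mem _ h =>
      obtain ⟨a, t, ht, rfl⟩ := h
      have key : (φ a * t) • (X : R[X]) ^ j • g
          = (C a * X ^ (j / q)) ^ q • C t • (X : R[X]) ^ (j % q) • g := by
        rw [← algebraMap_smul R[X] (φ a * t), algebraMap_eq, smul_smul, smul_smul, smul_smul]
        congr 1
        conv_lhs => rw [← Nat.mod_add_div j q]
        rw [hφ, C_mul, C_pow, mul_pow, ← pow_mul, pow_add, mul_comm q]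
        ring
      rw [key, hκ, mul_smul, ← algebraMap_eq, algebraMap_smul]
      refine Submodule.smul_mem _ a (degreeSpan_mono G
        (Nat.add_le_add_right (Nat.div_le_div_right hj) D) (X_pow_smul_mem_degreeSpan_add _
          (hD _ (Finset.mem_image.mpr ⟨(t, j % q, g), ?_, rfl⟩))))
      simp [ht, hg, Nat.mod_lt j hq]
  · rw [smul_add, map_add]
    exact add_mem (hx r) (hy r)

end

/-- Anderson's contraction claim from the proof of Theorem 3.2.14: for a finitely generated
Cartier module `M` over `R[X]` (with `R` Noetherian of characteristic `p` with finite
Frobenius), `M` contains a finitely generated `κ`-stable `R`-submodule `N` such that `M/N`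
is locally nilpotent over `R`. -/
theorem stmt_7 {R : Type*} [CommRing R] [IsNoetherianRing R]
    (p : ℕ) (hp : p.Prime) [CharP R p] (s : ℕ) (hs : 1 ≤ s) (q : ℕ) (hq : q = p ^ s)
    (φ : R →+* R) (hφ : ∀ r : R, φ r = r ^ q) (hfin : φ.Finite)
    {M : Type*} [AddCommGroup M] [Module (Polynomial R) M] [Module R M]
    [IsScalarTower R (Polynomial R) M] [Module.Finite (Polynomial R) M]
    (κ : M → M) (hadd : ∀ x y : M, κ (x + y) = κ x + κ y)
    (hκ : ∀ (f : Polynomial R) (m : M), κ (f ^ q • m) = f • κ m) :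
    ∃ N : Submodule R M, N.FG ∧ (∀ x ∈ N, κ x ∈ N) ∧
      ∀ U : Submodule R M, U.FG → ∃ e : ℕ, ∀ u ∈ U, κ^[e] u ∈ N := by
  have hq2 : 2 ≤ q := hq ▸ hp.two_le.trans (Nat.le_self_pow (by omega) p)
  obtain ⟨G, hG⟩ := Module.finite_def.mp ‹Module.Finite (Polynomial R) M›
  obtain ⟨D, hD⟩ := exists_map_degreeSpan_le (by omega) hφ hfin (AddMonoidHom.mk' κ hadd) hκ hG
  have step (d : ℕ) (x : M) (hx : x ∈ degreeSpan R G d) : κ x ∈ degreeSpan R G (d / 2 + D) :=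
    degreeSpan_mono G (Nat.add_le_add_right (Nat.div_le_div_left hq2 two_pos) D) (hD d x hx)
  refine ⟨degreeSpan R G (2 * D), degreeSpan_fg G _, fun x hx =>
    degreeSpan_mono G (by omega) (step _ x hx), fun U hU => ?_⟩
  have nil (d : ℕ) : ∃ e, ∀ u ∈ degreeSpan R G d, κ^[e] u ∈ degreeSpan R G (2 * D) := by
    induction d using Nat.strong_induction_on with
    | _ d ih =>
      rcases le_or_gt d (2 * D) with h | h
      · exact ⟨0, fun u hu => degreeSpan_mono G h hu⟩
      · obtain ⟨e, he⟩ := ih (d / 2 + D) (by omega)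
        exact ⟨e + 1, fun u hu => he _ (step d u hu)⟩
  obtain ⟨T, rfl⟩ := hU
  obtain ⟨d, hd⟩ := exists_forall_mem_degreeSpan hG T
  obtain ⟨e, he⟩ := nil d
  exact ⟨e, fun u hu => he u (Submodule.span_le.mpr hd hu)⟩
end

section
/- Let R be a Noetherian commutative ring of characteristic p whose Frobenius r ↦ r^q is a finite ring map, and let S be a finite type R-algebra. Let M be a finitely generated S-module equipped with an additive map κ : M → M satisfying κ(s^q • m) = s • κ(m) for all s ∈ S and m ∈ M. Then M contains a finitely generated R-submodule N with κ(N) ⊆ N such that M/N is locally nilpotent over R: for every finitely generated R-submodule U of M there exists e ≥ 0 with κ^e(U) ⊆ N. -/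
/-- The `R`-span of the elements `(∏ i, x i ^ a i) • m` with `m ∈ B` and all exponents at most
`d`. -/
def monomialSpan (R : Type*) {S M ι : Type*} [CommRing R] [CommRing S] [Fintype ι]
    [AddCommGroup M] [Module S M] [Module R M] (x : ι → S) (B : Set M) (d : ℕ) :
    Submodule R M :=
  Submodule.span R (Set.image2 (fun (a : ι → ℕ) m => (∏ i, x i ^ a i) • m)
    (Set.Iic fun _ => d) B)

section monomialSpan

variable {R S M ι : Type*} [CommRing R] [CommRing S] [Fintype ι]
  [AddCommGroup M] [Module S M] [Module R M] {x : ι → S} {B : Set M}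

theorem monomial_smul_mem_monomialSpan {d : ℕ} {a : ι → ℕ} (ha : ∀ i, a i ≤ d) {m : M}
    (hm : m ∈ B) : (∏ i, x i ^ a i) • m ∈ monomialSpan R x B d :=
  Submodule.subset_span ⟨a, ha, m, hm, rfl⟩

theorem monomialSpan_mono : Monotone (monomialSpan R x B) := by
  intro d d' h
  refine Submodule.span_mono (Set.image2_subset_right ?_)
  exact Set.Iic_subset_Iic.2 fun _ => h

theorem monomialSpan_fg (hB : B.Finite) (d : ℕ) : (monomialSpan R x B d).FG := by
  classical
  exact Submodule.fg_span ((Set.finite_Iic _).image2 _ hB)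

theorem monomial_smul_mem_monomialSpan_add [Algebra R S] [IsScalarTower R S M] {d k : ℕ}
    {b : ι → ℕ} (hb : ∀ i, b i ≤ k) {m : M} (hm : m ∈ monomialSpan R x B d) :
    (∏ i, x i ^ b i) • m ∈ monomialSpan R x B (k + d) := by
  refine Submodule.span_induction (p := fun m _ => (∏ i, x i ^ b i) • m ∈ _)
    ?_ ?_ ?_ ?_ hm
  · rintro _ ⟨a, ha, m, hm, rfl⟩
    dsimp only
    rw [smul_smul, ← Finset.prod_mul_distrib]
    simp_rw [← pow_add]
    exact monomial_smul_mem_monomialSpan (fun i => add_le_add (hb i) (ha i)) hm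
  · simp
  · intro y z _ _ hy hz
    rw [smul_add]
    exact add_mem hy hz
  · intro r y _ hy
    rw [smul_algebra_smul_comm]
    exact Submodule.smul_mem _ r hy

theorem exists_mem_monomialSpan [Algebra R S] [IsScalarTower R S M]
    (hx : Function.Surjective (MvPolynomial.aeval (R := R) x))
    (hB : Submodule.span S B = ⊤) (m : M) : ∃ d, m ∈ monomialSpan R x B d := by
  have hdir : Directed (· ≤ ·) (monomialSpan R x B) := monomialSpan_mono.directed_le
  rw [← Submodule.mem_iSup_of_directed _ hdir]
  have hm : m ∈ Submodule.span S B := hB ▸ Submodule.mem_top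
  rw [Submodule.mem_span_set'] at hm
  obtain ⟨n, c, g, rfl⟩ := hm
  refine sum_mem fun j _ => ?_
  obtain ⟨f, hf⟩ := hx (c j)
  rw [← hf, MvPolynomial.aeval_def, MvPolynomial.eval₂_eq', Finset.sum_smul]
  refine sum_mem fun a _ => ?_
  rw [mul_smul, algebraMap_smul]
  refine Submodule.smul_mem _ _ (Submodule.mem_iSup_of_mem (Finset.univ.sup a) ?_)
  exact monomial_smul_mem_monomialSpan (fun i => Finset.le_sup (Finset.mem_univ i)) (g j).2

theorem exists_subset_monomialSpan [Algebra R S] [IsScalarTower R S M]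
    (hx : Function.Surjective (MvPolynomial.aeval (R := R) x))
    (hB : Submodule.span S B = ⊤) {T : Set M} (hT : T.Finite) :
    ∃ d, T ⊆ monomialSpan R x B d := by
  choose d hd using exists_mem_monomialSpan (R := R) hx hB
  obtain ⟨D, hD⟩ := (hT.image d).bddAbove
  exact ⟨D, fun m hm => monomialSpan_mono (hD ⟨m, hm, rfl⟩) (hd m)⟩

end monomialSpan

/-- Iterating `κ` on the filtration contracts every step into the step of index `2 * D`. -/
theorem exists_iterate_mem_of_div_add {R M : Type*} [Semiring R] [AddCommMonoid M] [Module R M]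
    {F : ℕ → Submodule R M} (hF : Monotone F) {κ : M → M} {q D : ℕ} (hq : 2 ≤ q)
    (hκ : ∀ d, ∀ m ∈ F d, κ m ∈ F (d / q + D)) (d : ℕ) :
    ∃ e : ℕ, ∀ m ∈ F d, κ^[e] m ∈ F (2 * D) := by
  induction d using Nat.strong_induction_on with
  | _ d ih =>
    rcases le_or_gt d (2 * D) with h | h
    · exact ⟨0, fun m hm => hF h hm⟩
    · have hlt : d / q + D < d := by
        have : d / q ≤ d / 2 := Nat.div_le_div_left hq two_pos
        omega
      obtain ⟨e, he⟩ := ih _ hlt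
      exact ⟨e + 1, fun m hm => he _ (hκ d m hm)⟩

theorem RingHom.Finite.exists_finset_sum_mul {A B : Type*} [CommRing A] [CommRing B]
    {f : A →+* B} (hf : f.Finite) :
    ∃ E : Finset B, ∀ b : B, ∃ c : B → A, ∑ e ∈ E, f (c e) * e = b := by
  algebraize [f]
  obtain ⟨E, hE⟩ := Module.Finite.fg_top (R := A) (M := B)
  refine ⟨E, fun b => ?_⟩
  have hb : b ∈ Submodule.span A (E : Set B) := hE ▸ Submodule.mem_top
  obtain ⟨c, -, hc⟩ := Submodule.mem_span_finset.1 hb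
  exact ⟨c, hc⟩

/-- Theorem 3.2.14 (affine form): for a finitely generated Cartier module `M` over a finite
type `R`-algebra `S` (with `R` Noetherian of characteristic `p` with finite Frobenius), `M`
contains a finitely generated `κ`-stable `R`-submodule `N` such that `M/N` is locally
nilpotent over `R`. -/
theorem stmt_8 {R : Type*} [CommRing R] [IsNoetherianRing R]
    (p : ℕ) (hp : p.Prime) [CharP R p] (s : ℕ) (hs : 1 ≤ s) (q : ℕ) (hq : q = p ^ s)
    (φ : R →+* R) (hφ : ∀ r : R, φ r = r ^ q) (hfin : φ.Finite)
    {S : Type*} [CommRing S] [Algebra R S] [Algebra.FiniteType R S]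
    {M : Type*} [AddCommGroup M] [Module S M] [Module R M]
    [IsScalarTower R S M] [Module.Finite S M]
    (κ : M → M) (hadd : ∀ x y : M, κ (x + y) = κ x + κ y)
    (hκ : ∀ (t : S) (m : M), κ (t ^ q • m) = t • κ m) :
    ∃ N : Submodule R M, N.FG ∧ (∀ x ∈ N, κ x ∈ N) ∧
      ∀ U : Submodule R M, U.FG → ∃ e : ℕ, ∀ u ∈ U, κ^[e] u ∈ N := by
  classical
  have hq2 : 2 ≤ q := hq ▸ hp.two_le.trans (Nat.le_self_pow (by omega) p)
  obtain ⟨n, f, hf⟩ := Algebra.FiniteType.iff_quotient_mvPolynomial''.1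
    (inferInstance : Algebra.FiniteType R S)
  obtain ⟨x, rfl⟩ : ∃ x : Fin n → S, f = MvPolynomial.aeval x :=
    ⟨_, MvPolynomial.aeval_unique f⟩
  obtain ⟨B, hB⟩ := Module.Finite.fg_top (R := S) (M := M)
  obtain ⟨E, hE⟩ : ∃ E : Finset R, ∀ r : R, ∃ c : R → R, r = ∑ e ∈ E, c e ^ q * e := by
    obtain ⟨E, hE⟩ := hfin.exists_finset_sum_mul
    refine ⟨E, fun r => ?_⟩
    obtain ⟨c, hc⟩ := hE r
    exact ⟨c, by simp_rw [← hφ, hc]⟩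
  have hfinT : (Set.image2 (fun (er : R × M) (a : Fin n → ℕ) =>
      κ (er.1 • (∏ i, x i ^ a i) • er.2)) ((E : Set R) ×ˢ (B : Set M))
      (Set.Iic fun _ => q)).Finite :=
    (E.finite_toSet.prod B.finite_toSet).image2 _ (Set.finite_Iic _)
  obtain ⟨D, hD⟩ := exists_subset_monomialSpan (R := R) hf hB hfinT
  have hκR (r : R) (m : M) : κ (r ^ q • m) = r • κ m := by
    rw [← algebraMap_smul S, map_pow, hκ, algebraMap_smul]
  have key : ∀ d, ∀ m ∈ monomialSpan R x (B : Set M) d,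
      κ m ∈ monomialSpan R x (B : Set M) (d / q + D) := by
    intro d m hm
    obtain ⟨k, c, g, rfl⟩ := (Submodule.mem_span_set' ..).1 hm
    rw [← AddMonoidHom.mk'_apply κ hadd, map_sum]
    refine sum_mem fun j _ => ?_
    obtain ⟨a, ha, m, hmB, hg⟩ := (g j).2
    obtain ⟨r, hr⟩ := hE (c j)
    rw [← hg, hr, Finset.sum_smul, map_sum]
    refine sum_mem fun e he => ?_
    have hsplit : (∏ i, x i ^ a i) = (∏ i, x i ^ (a i / q)) ^ q * ∏ i, x i ^ (a i % q) := by
      rw [← Finset.prod_pow, ← Finset.prod_mul_distrib]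
      refine Finset.prod_congr rfl fun i _ => ?_
      rw [← pow_mul, ← pow_add, Nat.div_add_mod']
    dsimp only
    rw [hsplit, mul_smul, mul_smul, AddMonoidHom.mk'_apply, hκR, ← smul_algebra_smul_comm, hκ]
    refine Submodule.smul_mem _ _ (monomial_smul_mem_monomialSpan_add
      (fun i => Nat.div_le_div_right (ha i)) (hD ?_))
    exact ⟨(e, m), ⟨he, hmB⟩, _, fun i => (Nat.mod_lt _ (by omega)).le, rfl⟩
  have hF : Monotone (monomialSpan R x (B : Set M)) := monomialSpan_mono
  refine ⟨monomialSpan R x B (2 * D), monomialSpan_fg B.finite_toSet _, ?_, ?_⟩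
  · intro m hm
    refine hF ?_ (key _ m hm)
    have : 2 * D / q ≤ 2 * D / 2 := Nat.div_le_div_left hq2 two_pos
    omega
  · rintro U ⟨T, rfl⟩
    obtain ⟨d, hd⟩ := exists_subset_monomialSpan (R := R) hf hB T.finite_toSet
    obtain ⟨e, he⟩ := exists_iterate_mem_of_div_add hF hq2 key d
    exact ⟨e, fun u hu => he u (Submodule.span_le.2 hd hu)⟩
end

section
/- Let (R, 𝔪) be a Noetherian local commutative ring of characteristic p and M a finitely generated Cartier module (M, κ) over R that is supported at the closed point, i.e., 𝔪^n • M = 0 for some n ≥ 1. Let M[𝔪] := {m ∈ M : r • m = 0 for all r ∈ 𝔪}. Then M is nilpotent (κ^t(M) = 0 for some t ≥ 0) if and only if M[𝔪], with the restricted κ, is nilpotent (κ^s(M[𝔪]) = 0 for some s ≥ 0). -/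
/-- The iterates of a `q`-Cartier linear map are `q ^ k`-Cartier linear. -/
theorem iterate_pow_smul_of_cartierLinear {R M : Type*} [Monoid R] [MulAction R M] {q : ℕ}
    {κ : M → M} (hκ : ∀ (r : R) (m : M), κ (r ^ q • m) = r • κ m) (k : ℕ) (r : R) (m : M) :
    κ^[k] (r ^ q ^ k • m) = r • κ^[k] m := by
  induction k generalizing m with
  | zero => simp
  | succ k ih =>
    rw [Function.iterate_succ_apply, Function.iterate_succ_apply, pow_succ, pow_mul, hκ, ih]

/-- Lemma 4.3.1(a): for a finitely generated Cartier module `M` over a Noetherian local ring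
`(R, 𝔪)` of characteristic `p` which is supported at the closed point (killed by a power of
`𝔪`), `M` is nilpotent if and only if its `𝔪`-torsion part `M[𝔪]` is nilpotent. -/
theorem stmt_11 {R M : Type*} [CommRing R] [IsNoetherianRing R] [IsLocalRing R]
    [AddCommGroup M] [Module R M] [Module.Finite R M]
    (p : ℕ) (hp : p.Prime) [CharP R p] (s : ℕ) (hs : 1 ≤ s) (q : ℕ) (hq : q = p ^ s)
    (κ : M → M) (hadd : ∀ x y : M, κ (x + y) = κ x + κ y)
    (hκ : ∀ (r : R) (m : M), κ (r ^ q • m) = r • κ m)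
    (hsupp : ∃ n : ℕ, 1 ≤ n ∧ ∀ m : M, ∀ r ∈ (IsLocalRing.maximalIdeal R) ^ n, r • m = 0) :
    (∃ t : ℕ, ∀ m : M, κ^[t] m = 0) ↔
    (∃ e : ℕ, ∀ m : M, (∀ r ∈ IsLocalRing.maximalIdeal R, r • m = 0) → κ^[e] m = 0) := by
  refine ⟨fun ⟨t, ht⟩ => ⟨t, fun m _ => ht m⟩, fun ⟨e, he⟩ => ?_⟩
  obtain ⟨n, -, hn⟩ := hsupp
  have hq1 : 1 < q := hq ▸ Nat.one_lt_pow (by lia) hp.one_lt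
  have hzero : κ 0 = 0 := by simpa using hadd 0 0
  refine ⟨e + n, fun m => ?_⟩
  rw [Function.iterate_add_apply]
  refine he _ fun r hr => ?_
  have hmem : r ^ q ^ n ∈ IsLocalRing.maximalIdeal R ^ n :=
    Ideal.pow_le_pow_right (Nat.lt_pow_self hq1).le (Ideal.pow_mem_pow hr _)
  rw [← iterate_pow_smul_of_cartierLinear hκ, hn m _ hmem, Function.iterate_fixed hzero]
end

section
/- Let (R, 𝔪) be a Noetherian local commutative ring of characteristic p whose Frobenius r ↦ r^q is a finite ring map, and let M be a Cartier module (M, κ) over R such that every element of M is annihilated by some power of 𝔪. Let M[𝔪] := {m ∈ M : r • m = 0 for all r ∈ 𝔪}. Then M is locally nilpotent if and only if M[𝔪], with the restricted κ, is locally nilpotent. -/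
theorem iterate_eq_zero_of_le {M : Type*} [Zero M] {κ : M → M} (h0 : κ 0 = 0) {d e : ℕ}
    (hde : d ≤ e) {x : M} (hx : κ^[d] x = 0) : κ^[e] x = 0 := by
  obtain ⟨k, rfl⟩ := Nat.exists_eq_add_of_le' hde
  rw [Function.iterate_add_apply, hx, Function.iterate_fixed h0]

/-- The largest submodule annihilated by the `e`-th iterate of an additive map. -/
def iterateKernel {R M : Type*} [CommRing R] [AddCommGroup M] [Module R M]
    (κ : M →+ M) (e : ℕ) : Submodule R M where
  carrier := {x | ∀ r : R, κ^[e] (r • x) = 0}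
  zero_mem' r := by simp
  add_mem' {x y} hx hy r := by simp [smul_add, iterate_map_add, hx r, hy r]
  smul_mem' a x hx r := by simpa [smul_smul] using hx (r * a)

theorem map_mem_iterateKernel {R M : Type*} [CommRing R] [AddCommGroup M] [Module R M]
    {q : ℕ} (κ : M →+ M) (hκ : ∀ (r : R) (m : M), κ (r ^ q • m) = r • κ m) {e : ℕ} {x : M}
    (hx : x ∈ iterateKernel (R := R) κ e) : κ x ∈ iterateKernel (R := R) κ e := by
  intro r
  rw [← hκ, ← Function.iterate_succ_apply, Function.iterate_succ_apply', hx, map_zero]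

/-- With finite Frobenius, an element all of whose multiples are mapped by `κ` to elements
generating nilpotent Cartier submodules generates a nilpotent Cartier submodule itself. -/
theorem exists_mem_iterateKernel_of_map {R M : Type*} [CommRing R] [AddCommGroup M] [Module R M]
    {q : ℕ} (φ : R →+* R) (hφ : ∀ r : R, φ r = r ^ q) (hfin : φ.Finite)
    (κ : M →+ M) (hκ : ∀ (r : R) (m : M), κ (r ^ q • m) = r • κ m) (m : M)
    (h : ∀ b : R, ∃ e, κ (b • m) ∈ iterateKernel (R := R) κ e) :
    ∃ e, m ∈ iterateKernel (R := R) κ e := by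
  choose e he using h
  obtain ⟨S, hS⟩ := hfin
  refine ⟨S.sup e + 1, fun r ↦ ?_⟩
  have key : κ (r • m) ∈ iterateKernel (R := R) κ (S.sup e) := by
    have hr : r ∈ (⊤ : @Submodule R R _ _ φ.toAlgebra.toModule) := trivial
    rw [← hS] at hr
    induction hr using Submodule.span_induction with
    | mem x hx =>
      exact fun c ↦ iterate_eq_zero_of_le (map_zero κ) (Finset.le_sup hx) (he x c)
    | zero => simp
    | add x y _ _ hx hy => simpa [add_smul] using add_mem hx hy
    | smul a x _ hx =>
      change κ ((φ a * x) • m) ∈ _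
      rw [hφ, mul_smul, hκ]
      exact Submodule.smul_mem _ a hx
  simpa using key 1

theorem exists_mem_iterateKernel_of_torsion {R M : Type*} [CommRing R] [AddCommGroup M]
    [Module R M] {q : ℕ} (hq : 2 ≤ q) (φ : R →+* R) (hφ : ∀ r : R, φ r = r ^ q) (hfin : φ.Finite)
    (κ : M →+ M) (hκ : ∀ (r : R) (m : M), κ (r ^ q • m) = r • κ m) (I : Ideal R)
    (h : ∀ m : M, (∀ r ∈ I, r • m = 0) → ∃ e, m ∈ iterateKernel (R := R) κ e)
    (n : ℕ) (m : M) (hm : ∀ r ∈ I ^ (n + 1), r • m = 0) :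
    ∃ e, m ∈ iterateKernel (R := R) κ e := by
  induction n generalizing m with
  | zero => exact h m (by simpa using hm)
  | succ n ih =>
    refine exists_mem_iterateKernel_of_map φ hφ hfin κ hκ m fun b ↦ ih _ fun r hr ↦ ?_
    have hrq : r ^ q ∈ I ^ (n + 1 + 1) := by
      have h1 : r ^ q ∈ I ^ ((n + 1) * q) := pow_mul I (n + 1) q ▸ Ideal.pow_mem_pow hr q
      exact Ideal.pow_le_pow_right (by nlinarith) h1
    rw [← hκ, smul_comm, hm _ hrq, smul_zero, map_zero]

/-- Lemma 4.3.1(b): for a Cartier module `M` over a Noetherian local ring `(R, 𝔪)` of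
characteristic `p` with finite Frobenius, all of whose elements are annihilated by a power
of `𝔪`, `M` is locally nilpotent if and only if its `𝔪`-torsion part `M[𝔪]` (with the
restricted `κ`) is locally nilpotent. -/
theorem stmt_12 {R M : Type*} [CommRing R] [IsNoetherianRing R] [IsLocalRing R]
    [AddCommGroup M] [Module R M]
    (p : ℕ) (hp : p.Prime) [CharP R p] (s : ℕ) (hs : 1 ≤ s) (q : ℕ) (hq : q = p ^ s)
    (φ : R →+* R) (hφ : ∀ r : R, φ r = r ^ q) (hfin : φ.Finite)
    (κ : M → M) (hadd : ∀ x y : M, κ (x + y) = κ x + κ y)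
    (hκ : ∀ (r : R) (m : M), κ (r ^ q • m) = r • κ m)
    (htors : ∀ m : M, ∃ n : ℕ, ∀ r ∈ (IsLocalRing.maximalIdeal R) ^ n, r • m = 0) :
    -- `M` is locally nilpotent
    (∀ m : M, ∃ N : Submodule R M, m ∈ N ∧ (∀ x ∈ N, κ x ∈ N) ∧
        ∃ e : ℕ, ∀ x ∈ N, κ^[e] x = 0) ↔
    -- `M[𝔪]` (with the restricted `κ`) is locally nilpotent
    (∀ m : M, (∀ r ∈ IsLocalRing.maximalIdeal R, r • m = 0) →
      ∃ N : Submodule R M, m ∈ N ∧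
        (∀ x ∈ N, ∀ r ∈ IsLocalRing.maximalIdeal R, r • x = 0) ∧
        (∀ x ∈ N, κ x ∈ N) ∧
        ∃ e : ℕ, ∀ x ∈ N, κ^[e] x = 0) := by
  have hq2 : 2 ≤ q := hq ▸ hp.two_le.trans (Nat.le_self_pow (by lia) p)
  constructor
  · intro h m hm
    obtain ⟨N, hmN, hN, e, he⟩ := h m
    refine ⟨N ⊓ Submodule.torsionBySet R M (IsLocalRing.maximalIdeal R), ⟨hmN, ?_⟩, ?_, ?_,
      e, fun x hx ↦ he x hx.1⟩
    · exact (Submodule.mem_torsionBySet_iff _ _).2 fun r ↦ hm r r.2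
    · exact fun x hx r hr ↦ (Submodule.mem_torsionBySet_iff _ _).1 hx.2 ⟨r, hr⟩
    · intro x hx
      refine ⟨hN x hx.1, (Submodule.mem_torsionBySet_iff _ _).2 fun r ↦ ?_⟩
      have hrq : (r : R) ^ q ∈ IsLocalRing.maximalIdeal R :=
        Ideal.pow_mem_of_mem _ r.2 q (by lia)
      have h0 := (Submodule.mem_torsionBySet_iff _ _).1 hx.2 ⟨_, hrq⟩
      rw [← hκ, h0]
      simpa using hadd 0 0
  · intro h m
    let k : M →+ M := AddMonoidHom.mk' κ hadd
    obtain ⟨n, hn⟩ := htors m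
    obtain ⟨e, he⟩ := exists_mem_iterateKernel_of_torsion hq2 φ hφ hfin k hκ
      (IsLocalRing.maximalIdeal R) (fun x hx ↦ by
        obtain ⟨N, hxN, -, -, e, he⟩ := h x hx
        exact ⟨e, fun r ↦ he _ (N.smul_mem r hxN)⟩)
      n m (fun r hr ↦ hn r (Ideal.pow_le_pow_right n.le_succ hr))
    exact ⟨iterateKernel k e, he, fun x hx ↦ map_mem_iterateKernel k hκ hx, e,
      fun x hx ↦ one_smul R x ▸ hx 1⟩
end

section
/- Let A be a Noetherian commutative ring and σ : A → A a ring homomorphism whose induced map on prime spectra (the comap of σ) is bijective. Let M be a finitely generated A-module with an additive map κ : M → M satisfying κ(σ(a) • m) = a • κ(m) for all a ∈ A, m ∈ M. Then the sets Supp(κ^e(M)) (the support of the A-submodule κ^e(M) of M, for e ≥ 0) form a descending chain of closed subsets of Spec A which becomes stationary, and its stable value T satisfies (comap σ)(T) = T. -/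
/-- If `κ : M → N` is a surjective additive map with `κ (σ a • m) = a • κ m`, then `Supp N` is
contained in the image of `Supp M` under `Spec σ`. -/
theorem support_subset_comap_image_of_cartier_surjective {A B M N : Type*} [CommRing A]
    [CommRing B] (σ : A →+* B) [AddCommGroup M] [Module B M] [Module.Finite B M]
    [AddCommGroup N] [Module A N] [Module.Finite A N] (κ : M →+ N)
    (hκ : ∀ (a : A) (m : M), κ (σ a • m) = a • κ m) (hsurj : Function.Surjective κ) :
    Module.support A N ⊆ PrimeSpectrum.comap σ '' Module.support B M := by
  intro q hq
  have hmem (x : M) (hx : x ∈ q.asIdeal.map σ • (⊤ : Submodule B M)) :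
      κ x ∈ q.asIdeal • (⊤ : Submodule A N) := by
    refine Submodule.smul_induction_on hx (fun r hr m _ ↦ ?_) fun x y hx hy ↦ ?_
    · induction hr using Submodule.span_induction generalizing m with
      | mem r hr =>
        obtain ⟨a, ha, rfl⟩ := hr
        rw [hκ]
        exact Submodule.smul_mem_smul ha trivial
      | zero => simp
      | add r s _ _ hr hs =>
        rw [add_smul, map_add]
        exact add_mem (hr m trivial) (hs m trivial)
      | smul b r _ hr =>
        rw [smul_eq_mul, mul_comm, mul_smul]
        exact hr _ trivial
    · rw [map_add]
      exact add_mem hx hy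
  have hle : (Module.annihilator B M ⊔ q.asIdeal.map σ).comap σ ≤ q.asIdeal := by
    intro s hs
    obtain ⟨a, ha, b, hb, hab⟩ := Submodule.mem_sup.mp (Ideal.mem_comap.mp hs)
    have hq' : q ∈ Module.support A (N ⧸ q.asIdeal • (⊤ : Submodule A N)) := by
      rw [Module.support_quotient]
      exact ⟨hq, (PrimeSpectrum.mem_zeroLocus _ _).mpr subset_rfl⟩
    refine Module.annihilator_le_of_mem_support hq' (Module.mem_annihilator.mpr fun y ↦ ?_)
    obtain ⟨n, rfl⟩ := Submodule.Quotient.mk_surjective _ y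
    obtain ⟨m, rfl⟩ := hsurj n
    rw [← Submodule.Quotient.mk_smul, Submodule.Quotient.mk_eq_zero, ← hκ, ← hab, add_smul,
      Module.mem_annihilator.mp ha, zero_add]
    exact hmem _ (Submodule.smul_mem_smul hb trivial)
  obtain ⟨Q, hQ, hQprime, hQle⟩ := Ideal.exists_ideal_comap_le_prime _ _ hle
  refine ⟨⟨Q, hQprime⟩, ?_, ?_⟩
  · rw [Module.support_eq_zeroLocus]
    exact le_sup_left.trans hQ
  · exact PrimeSpectrum.ext (le_antisymm hQle
      (Ideal.map_le_iff_le_comap.mp (le_sup_right.trans hQ)))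

/-- A closed subset `T` of a Noetherian space is stable under every continuous bijection whose
image of `T` contains `T`. -/
theorem IsClosed.image_eq_of_subset_image_of_bijective {X : Type*} [TopologicalSpace X]
    [TopologicalSpace.NoetherianSpace X] {f : X → X} (hf : Continuous f)
    (hbij : Function.Bijective f) {T : Set X} (hT : IsClosed T) (hsub : T ⊆ f '' T) :
    f '' T = T := by
  have hpre : f ⁻¹' T ⊆ T := by
    simpa only [Set.preimage_image_eq _ hbij.injective] using Set.preimage_mono (f := f) hsub
  let Z (n : ℕ) : TopologicalSpace.Closeds X := ⟨f^[n] ⁻¹' T, hT.preimage (hf.iterate n)⟩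
  have hZ : Antitone Z := antitone_nat_of_succ_le fun n ↦ by
    change f^[n + 1] ⁻¹' T ⊆ f^[n] ⁻¹' T
    rw [Function.iterate_succ', Set.preimage_comp]
    exact Set.preimage_mono hpre
  obtain ⟨n, hn⟩ := WellFoundedLT.antitone_chain_condition hZ
  have h : f^[n] ⁻¹' T = f^[n] ⁻¹' (f ⁻¹' T) := by
    rw [← Set.preimage_comp, ← Function.iterate_succ']
    exact congrArg (fun C : TopologicalSpace.Closeds X ↦ (C : Set X)) (hn (n + 1) n.le_succ)
  have h' : T = f ⁻¹' T := (hbij.surjective.iterate n).preimage_injective h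
  conv_lhs => rw [h']
  exact Set.image_preimage_eq _ hbij.surjective

/-- Lemma 4.3.11: for a finitely generated `σ`-Cartier module `M` over a Noetherian ring `A`
(with `Spec σ` bijective), the supports of the submodules `κ^e(M)` form a descending chain
of closed subsets of `Spec A` which becomes stationary, and the stable value `T` satisfies
`(Spec σ)(T) = T`. -/
theorem stmt_14 {A : Type*} [CommRing A] [IsNoetherianRing A]
    (σ : A →+* A) (hσ : Function.Bijective (PrimeSpectrum.comap σ))
    {M : Type*} [AddCommGroup M] [Module A M] [Module.Finite A M]
    (κ : M → M) (hadd : ∀ x y : M, κ (x + y) = κ x + κ y)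
    (hκ : ∀ (a : A) (m : M), κ (σ a • m) = a • κ m)
    -- `K e` is the `A`-submodule `κ^e(M)` of `M`
    (K : ℕ → Submodule A M) (hK : ∀ e : ℕ, (K e : Set M) = Set.range (κ^[e])) :
    (∀ e : ℕ, Module.support A ↥(K (e + 1)) ⊆ Module.support A ↥(K e)) ∧
    (∀ e : ℕ, IsClosed (Module.support A ↥(K e))) ∧
    (∃ e₀ : ℕ, (∀ e : ℕ, e₀ ≤ e → Module.support A ↥(K e) = Module.support A ↥(K e₀)) ∧
      PrimeSpectrum.comap σ '' Module.support A ↥(K e₀) = Module.support A ↥(K e₀)) := by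
  have hclosed (e : ℕ) : IsClosed (Module.support A (K e)) := by
    rw [Module.support_eq_zeroLocus]
    exact PrimeSpectrum.isClosed_zeroLocus _
  have hmono (e : ℕ) : Module.support A (K (e + 1)) ⊆ Module.support A (K e) := by
    have hle : K (e + 1) ≤ K e := by
      rw [← SetLike.coe_subset_coe, hK, hK, Function.iterate_succ]
      exact Set.range_comp_subset_range _ _
    exact Module.support_subset_of_injective _ (Submodule.inclusion_injective hle)
  have himage (e : ℕ) : κ '' (K e : Set M) = K (e + 1) := by
    rw [hK, hK, Function.iterate_succ', Set.range_comp]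
  have hsub (e : ℕ) :
      Module.support A (K (e + 1)) ⊆ PrimeSpectrum.comap σ '' Module.support A (K e) := by
    have hmaps (x : K e) : κ x ∈ K (e + 1) :=
      (himage e).subset (Set.mem_image_of_mem κ x.2)
    refine support_subset_comap_image_of_cartier_surjective σ
      (AddMonoidHom.mk' (fun x : K e ↦ (⟨κ x, hmaps x⟩ : K (e + 1)))
        fun x y ↦ Subtype.ext (hadd x y)) (fun a m ↦ Subtype.ext (hκ a m)) ?_
    rintro ⟨y, hy⟩
    obtain ⟨x, hx, rfl⟩ := (himage e).superset hy
    exact ⟨⟨x, hx⟩, rfl⟩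
  let S (e : ℕ) : TopologicalSpace.Closeds (PrimeSpectrum A) := ⟨_, hclosed e⟩
  obtain ⟨e₀, he₀⟩ := WellFoundedLT.antitone_chain_condition
    (f := S) (antitone_nat_of_succ_le hmono)
  have hstable (e : ℕ) (he : e₀ ≤ e) : Module.support A (K e) = Module.support A (K e₀) :=
    congrArg (fun C : TopologicalSpace.Closeds (PrimeSpectrum A) ↦ (C : Set (PrimeSpectrum A)))
      (he₀ e he).symm
  refine ⟨hmono, hclosed, e₀, hstable, ?_⟩
  refine (hclosed e₀).image_eq_of_subset_image_of_bijective
    (PrimeSpectrum.continuous_comap σ) hσ ?_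
  exact (hstable (e₀ + 1) e₀.le_succ).symm.subset.trans (hsub e₀)
end

section
/- Let A be a Noetherian commutative ring and σ : A → A a ring homomorphism whose induced map on prime spectra (the comap of σ) is bijective. Let M and N be finitely generated σ-Cartier modules over A and φ : M → N an A-linear map with φ ∘ κ_M = κ_N ∘ φ such that for some e ≥ 0 one has κ_M^e(ker φ) = 0 and κ_N^e(N) ⊆ im φ (φ is a nil-isomorphism). Then ⋂_{e≥0} Supp(κ_M^e(M)) = ⋂_{e≥0} Supp(κ_N^e(N)) as subsets of Spec A; i.e., nil-isomorphic coherent Cartier modules have the same crystalline support. -/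
/-- Some positive iterate of a self-map of a finite type is idempotent. -/
theorem Function.exists_iterate_add_self_eq {α : Type*} [Finite α] (g : α → α) :
    ∃ k, 0 < k ∧ ∀ x, g^[k] (g^[k] x) = g^[k] x := by
  obtain ⟨i, j, hij, h⟩ : ∃ i j, i < j ∧ g^[i] = g^[j] := by
    obtain ⟨i, j, hne, h⟩ := Finite.exists_ne_map_eq_of_infinite (fun n : ℕ => g^[n])
    rcases hne.lt_or_gt with hlt | hlt
    exacts [⟨i, j, hlt, h⟩, ⟨j, i, hlt, h.symm⟩]
  obtain ⟨d, rfl⟩ := Nat.exists_eq_add_of_lt hij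
  have hper : ∀ c m, i ≤ m → g^[m + (d + 1) * c] = g^[m] := by
    intro c
    induction c with
    | zero => simp
    | succ c ih =>
      intro m hm
      obtain ⟨r, rfl⟩ := Nat.exists_eq_add_of_le hm
      rw [← ih _ hm, show i + r + (d + 1) * (c + 1) = (i + d + 1) + (r + (d + 1) * c) by ring,
        Function.iterate_add, ← h, ← Function.iterate_add, add_assoc]
  refine ⟨(d + 1) * (i + 1), by positivity, fun x => ?_⟩
  rw [← Function.iterate_add_apply, hper _ _ (by nlinarith)]

theorem StrictMono.not_apply_lt {α : Type*} [Preorder α] [WellFoundedLT α] {s : α → α}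
    (hs : StrictMono s) (x : α) : ¬ s x < x := by
  intro hx
  obtain ⟨m, hm, hmin⟩ := wellFounded_lt.has_min {y | s y < y} ⟨x, hx⟩
  exact hmin _ (hs hm) hm

/-- If every element of a finite antichain `S` lies above the image of an element of `S` under a
strictly monotone self-map of a well-founded order, then the map preserves `S`. -/
theorem StrictMono.mapsTo_of_finite_antichain {α : Type*} [PartialOrder α] [WellFoundedLT α]
    {s : α → α} (hs : StrictMono s) {S : Set α} (hfin : S.Finite)
    (hanti : IsAntichain (· ≤ ·) S) (h : ∀ z ∈ S, ∃ w ∈ S, s w ≤ z) : Set.MapsTo s S S := by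
  have := hfin.to_subtype
  choose g hg using fun z : S => (⟨⟨_, (h z z.2).choose_spec.1⟩, (h z z.2).choose_spec.2⟩ :
    ∃ w : S, s w ≤ z)
  have hiter : ∀ (n : ℕ) (z : S), s^[n] (g^[n] z) ≤ (z : α) := by
    intro n
    induction n with
    | zero => simp
    | succ n ih =>
      intro z
      rw [Function.iterate_succ_apply', Function.iterate_succ_apply]
      exact (hs.monotone (ih (g z))).trans (hg z)
  have hle : ∀ (n : ℕ) (x : α), s^[n] x ≤ x → s^[n] x = x := fun n x hx =>
    hx.eq_of_not_lt ((hs.iterate n).not_apply_lt x)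
  obtain ⟨k, hk, hidem⟩ := Function.exists_iterate_add_self_eq g
  have hfix : ∀ z : S, g^[k] z = z := by
    intro z
    have h1 := hiter k (g^[k] z)
    rw [hidem] at h1
    have h2 := hiter k z
    rw [hle k _ h1] at h2
    exact Subtype.ext (hanti.eq (g^[k] z).2 z.2 h2)
  obtain ⟨n, rfl⟩ := Nat.exists_eq_add_of_lt hk
  rw [zero_add] at hfix
  have hsg : ∀ z : S, s (g z) = z := by
    intro z
    have hz : s^[n + 1] (z : α) = z := by
      apply hle
      simpa [hfix z] using hiter (n + 1) z
    refine (hg z).antisymm ?_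
    have h1 := hs.monotone (hiter n (g z))
    rwa [← Function.iterate_succ_apply, ← Function.iterate_succ_apply' s, hfix, hz] at h1
  intro w hw
  have h1 : g (g^[n] ⟨w, hw⟩) = ⟨w, hw⟩ := by
    rw [← Function.iterate_succ_apply' g, hfix]
  have h2 := hsg (g^[n] ⟨w, hw⟩)
  rw [h1] at h2
  exact h2 ▸ (g^[n] ⟨w, hw⟩).2

theorem PrimeSpectrum.wellFoundedLT_of_isNoetherianRing (A : Type*) [CommRing A]
    [IsNoetherianRing A] : WellFoundedLT (PrimeSpectrum A) :=
  StrictMono.wellFoundedLT (f := fun p : PrimeSpectrum A => p.asIdeal.height)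
    fun _ _ h => Ideal.height_strict_mono_of_isPrime_of_isPrime h

/-- If `Spec σ` is injective and `V(I)` is contained in the closure of its own image under `Spec σ`,
then `Spec σ` preserves `V(I)`. -/
theorem PrimeSpectrum.mapsTo_comap_zeroLocus {A : Type*} [CommRing A] [IsNoetherianRing A]
    {σ : A →+* A} (hσ : Function.Injective (PrimeSpectrum.comap σ)) {I : Ideal A}
    (hI : ∀ p : PrimeSpectrum A, I ≤ p.asIdeal → I.comap σ ≤ p.asIdeal) :
    Set.MapsTo (PrimeSpectrum.comap σ) (PrimeSpectrum.zeroLocus (I : Set A))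
      (PrimeSpectrum.zeroLocus (I : Set A)) := by
  have := PrimeSpectrum.wellFoundedLT_of_isNoetherianRing A
  have hmono : StrictMono (PrimeSpectrum.comap σ) :=
    Monotone.strictMono_of_injective (fun _ _ h => Ideal.comap_mono (f := σ) h) hσ
  have key := hmono.mapsTo_of_finite_antichain
    (S := PrimeSpectrum.asIdeal ⁻¹' I.minimalPrimes)
    ((I.finite_minimalPrimes_of_isNoetherianRing A).preimage
      (fun _ _ _ _ h => PrimeSpectrum.ext h))
    (fun _ hp _ hq hne hle => hne (le_antisymm hle (hq.2 hp.1 hle)))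
    (by
      intro p hp
      obtain ⟨Q, hIQ, hQ, hQp⟩ := Ideal.exists_ideal_comap_le_prime p.asIdeal I (hI p hp.1.2)
      obtain ⟨w, hw, hwQ⟩ := Ideal.exists_minimalPrimes_le hIQ
      exact ⟨⟨w, hw.1.1⟩, hw, (Ideal.comap_mono (f := σ) hwQ).trans hQp⟩)
  intro p hp
  obtain ⟨w, hw, hwp⟩ := Ideal.exists_minimalPrimes_le (I := I) (J := p.asIdeal) hp
  exact ((key (x := ⟨w, hw.1.1⟩) hw).1.2).trans (Ideal.comap_mono (f := σ) hwp)

/-- If `V(I)` is stable under `Spec σ`, then a prime containing `σ⁻ᵉ(I)` contains `I`. -/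
theorem PrimeSpectrum.le_of_comap_iterate_le {A : Type*} [CommRing A] {σ : A →+* A} {I : Ideal A}
    (hI : Set.MapsTo (PrimeSpectrum.comap σ) (PrimeSpectrum.zeroLocus (I : Set A))
      (PrimeSpectrum.zeroLocus (I : Set A))) (e : ℕ) (p : PrimeSpectrum A)
    (hp : ∀ a, σ^[e] a ∈ I → a ∈ p.asIdeal) : I ≤ p.asIdeal := by
  have hpow : ∀ a, (σ ^ e) a = σ^[e] a := fun a => congrFun (RingHom.coe_pow σ e) a
  obtain ⟨Q, hIQ, hQ, hQp⟩ := Ideal.exists_ideal_comap_le_prime (f := σ ^ e) p.asIdeal I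
    (fun a ha => hp a (by rwa [← hpow]))
  refine le_trans ?_ hQp
  have hiter : ∀ n, I ≤ Q.comap (σ ^ n) := by
    intro n
    induction n with
    | zero => simpa [RingHom.one_def, Ideal.comap_id] using hIQ
    | succ n ih =>
      have h1 := hI (x := ⟨Q.comap (σ ^ n), inferInstance⟩) ih
      rw [pow_succ]
      exact h1
  exact hiter e

section CartierModule

variable {A M : Type*} [CommRing A] [AddCommGroup M] [Module A M] {σ : A →+* A} {κ : M → M}

theorem cartier_iterate_smul (hκ : ∀ (a : A) (m : M), κ (σ a • m) = a • κ m) (e : ℕ) (a : A)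
    (m : M) : κ^[e] (σ^[e] a • m) = a • κ^[e] m := by
  induction e generalizing m with
  | zero => rfl
  | succ e ih => rw [Function.iterate_succ_apply, Function.iterate_succ_apply' σ, hκ, ih,
      Function.iterate_succ_apply]

theorem mem_annihilator_iff_of_coe_eq_range {K : Submodule A M} {f : M → M}
    (hK : (K : Set M) = Set.range f) (a : A) :
    a ∈ Module.annihilator A K ↔ ∀ x, a • f x = 0 := by
  have hmem : ∀ y, y ∈ K ↔ y ∈ Set.range f := fun y => by rw [← hK]; rfl
  rw [← Submodule.annihilator, Submodule.mem_annihilator]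
  simp [hmem]

end CartierModule


/-- Proposition 4.3.13: nil-isomorphic finitely generated `σ`-Cartier modules over a
Noetherian ring `A` (with `Spec σ` bijective) have the same crystalline support
`⋂_e Supp(κ^e(·))`. -/
theorem stmt_15 {A : Type*} [CommRing A] [IsNoetherianRing A]
    (σ : A →+* A) (hσ : Function.Bijective (PrimeSpectrum.comap σ))
    {M N : Type*} [AddCommGroup M] [Module A M] [Module.Finite A M]
    [AddCommGroup N] [Module A N] [Module.Finite A N]
    (κM : M → M) (κN : N → N)
    (haddM : ∀ x y : M, κM (x + y) = κM x + κM y)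
    (hκM : ∀ (a : A) (m : M), κM (σ a • m) = a • κM m)
    (haddN : ∀ x y : N, κN (x + y) = κN x + κN y)
    (hκN : ∀ (a : A) (m : N), κN (σ a • m) = a • κN m)
    (φ : M →ₗ[A] N) (hφκ : ∀ x : M, φ (κM x) = κN (φ x))
    -- `φ` is a nil-isomorphism
    (hnil : ∃ e : ℕ, (∀ x : M, φ x = 0 → κM^[e] x = 0) ∧
      (∀ y : N, κN^[e] y ∈ LinearMap.range φ))
    -- `KM e` is the `A`-submodule `κM^e(M)` of `M`, and similarly `KN e`
    (KM : ℕ → Submodule A M) (hKM : ∀ e : ℕ, (KM e : Set M) = Set.range (κM^[e]))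
    (KN : ℕ → Submodule A N) (hKN : ∀ e : ℕ, (KN e : Set N) = Set.range (κN^[e])) :
    (⋂ e : ℕ, Module.support A ↥(KM e)) = ⋂ e : ℕ, Module.support A ↥(KN e) := by
  obtain ⟨e, hker, hcoker⟩ := hnil
  have hφκ' : ∀ (f : ℕ) (x : M), φ (κM^[f] x) = κN^[f] (φ x) := fun f x =>
    Function.Semiconj.iterate_right hφκ f x
  have hannM := fun f => mem_annihilator_iff_of_coe_eq_range (hKM f)
  have hannN := fun f => mem_annihilator_iff_of_coe_eq_range (hKN f)
  have hzero : ∀ f, κN^[f] 0 = 0 := fun f => by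
    simpa using cartier_iterate_smul hκN f 0 0
  have hmono : Monotone fun f => Module.annihilator A (KN f) := by
    refine monotone_nat_of_le_succ fun f a ha => ?_
    rw [hannN] at ha ⊢
    intro x
    rw [Function.iterate_succ_apply]
    exact ha _
  obtain ⟨f, hf⟩ := monotone_stabilizes_iff_noetherian.mpr inferInstance
    (⟨_, hmono⟩ : ℕ →o Ideal A)
  change ∀ g, f ≤ g → Module.annihilator A (KN f) = Module.annihilator A (KN g) at hf
  have hstable := PrimeSpectrum.mapsTo_comap_zeroLocus hσ.1
    (I := Module.annihilator A (KN f)) (by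
      intro p hp
      refine le_trans (fun a ha => ?_) hp
      rw [hf (f + 1) (Nat.le_succ f), hannN]
      rw [Ideal.mem_comap, hannN] at ha
      intro x
      rw [Function.iterate_succ_apply', ← hκN, ha]
      exact hzero 1)
  ext p
  simp only [Set.mem_iInter, Module.mem_support_iff_of_finite]
  constructor
  · intro hp
    have hle : Module.annihilator A (KN f) ≤ p.asIdeal := by
      refine PrimeSpectrum.le_of_comap_iterate_le hstable e p fun a ha => hp (e + f) ?_
      rw [hannN] at ha
      rw [hannM]
      intro x
      rw [Function.iterate_add_apply, ← cartier_iterate_smul hκM]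
      apply hker
      rw [map_smul, hφκ', ha]
    intro g
    refine (hmono (le_max_right f g)).trans ?_
    change Module.annihilator A (KN (max f g)) ≤ _
    rwa [← hf _ (le_max_left f g)]
  · intro hp g a ha
    apply hp (g + e)
    rw [hannM] at ha
    rw [hannN]
    intro y
    obtain ⟨x, hx⟩ := hcoker y
    rw [Function.iterate_add_apply, ← hx, ← hφκ', ← map_smul, ha, map_zero]
end
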